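/- arXiv:2209.08394 — 2 statements merged into one kernel-verified Lean document; each statement's English description precedes it below -/
import Mathlib

section
/- Let n ≥ 3, let Ω ⊆ ℝⁿ be a bounded open set, and let f : Ω → ℝ be a bounded continuous function. If there exists v ∈ C²(Ω, ℝ) such that Δv(x) = −f(x) for every x ∈ Ω (a classical solution of the Poisson equation), then the restriction to Ω of the Newtonian potential u_f is of class C² on Ω. Consequently, if u_f |_Ω ∉ C²(Ω, ℝ), the Poisson equation Δv = −f admits no classical solution on Ω. -/
open MeasureTheory Filter Topology Metric

/-- The classical Laplacian `Δu = Σᵢ ∂²u/∂xᵢ²` on `ℝⁿ` (Euclidean space). -/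
noncomputable def laplacian {n : ℕ} (u : EuclideanSpace ℝ (Fin n) → ℝ)
    (x : EuclideanSpace ℝ (Fin n)) : ℝ :=
  ∑ i : Fin n,
    fderiv ℝ (fun y => fderiv ℝ u y (EuclideanSpace.single i 1)) x (EuclideanSpace.single i 1)

/-- `ω_n`, the volume of the unit ball of `ℝⁿ`. -/
noncomputable def unitBallVol (n : ℕ) : ℝ :=
  (volume (ball (0 : EuclideanSpace ℝ (Fin n)) 1)).toReal

/-- `c_n = 1/(n(n-2)ω_n)`. -/
noncomputable def fundConst (n : ℕ) : ℝ :=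
  1 / (n * (n - 2) * unitBallVol n)

/-- The fundamental solution `Γ(z) = c_n |z|^{2-n}` of the Laplace equation, `n ≥ 3`. -/
noncomputable def fundSol (n : ℕ) (z : EuclideanSpace ℝ (Fin n)) : ℝ :=
  fundConst n * ‖z‖ ^ ((2 : ℝ) - n)

/-- The Newtonian potential `u_f(x) = ∫_Ω Γ(y-x) f(y) dy`. -/
noncomputable def newtonianPotential {n : ℕ} (Ω : Set (EuclideanSpace ℝ (Fin n)))
    (f : EuclideanSpace ℝ (Fin n) → ℝ) (x : EuclideanSpace ℝ (Fin n)) : ℝ :=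
  ∫ y in Ω, fundSol n (y - x) * f y

section RegularizedKernel

open scoped RealInnerProductSpace

variable {E : Type*} [NormedAddCommGroup E] [InnerProductSpace ℝ E]

theorem contDiff_add_norm_sq_rpow {s : ℝ} (hs : 0 < s) (a : ℝ) (k : WithTop ℕ∞) :
    ContDiff ℝ k fun y : E => (s + ‖y‖ ^ 2) ^ a :=
  (contDiff_const.add (contDiff_norm_sq ℝ)).rpow_const_of_ne fun y => by positivity

theorem hasFDerivAt_add_norm_sq_rpow {s : ℝ} (hs : 0 < s) (a : ℝ) (y : E) :
    HasFDerivAt (fun y : E => (s + ‖y‖ ^ 2) ^ a)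
      ((a * (s + ‖y‖ ^ 2) ^ (a - 1)) • ((2 : ℝ) • innerSL ℝ y)) y := by
  have h := ((hasStrictFDerivAt_norm_sq y).hasFDerivAt.const_add s).rpow_const (p := a)
    (Or.inl (by positivity))
  convert h using 2
  simp [two_smul]

theorem fderiv_add_norm_sq_rpow_apply {s : ℝ} (hs : 0 < s) (a : ℝ) (y v : E) :
    fderiv ℝ (fun y : E => (s + ‖y‖ ^ 2) ^ a) y v = 2 * a * ⟪v, y⟫ * (s + ‖y‖ ^ 2) ^ (a - 1) := by
  rw [(hasFDerivAt_add_norm_sq_rpow hs a y).fderiv]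
  simp [real_inner_comm]
  ring

theorem fderiv_fderiv_add_norm_sq_rpow_apply {s : ℝ} (hs : 0 < s) (a : ℝ) (y v : E) :
    fderiv ℝ (fun z => fderiv ℝ (fun y : E => (s + ‖y‖ ^ 2) ^ a) z v) y v =
      2 * a * (‖v‖ ^ 2 * (s + ‖y‖ ^ 2) ^ (a - 1)
        + 2 * (a - 1) * ⟪v, y⟫ ^ 2 * (s + ‖y‖ ^ 2) ^ (a - 2)) := by
  simp only [fderiv_add_norm_sq_rpow_apply hs]
  have h1 : HasFDerivAt (fun z : E => 2 * a * ⟪v, z⟫) ((2 * a) • innerSL ℝ v) y :=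
    ((innerSL ℝ v).hasFDerivAt).const_mul (2 * a)
  rw [show fderiv ℝ (fun z : E => 2 * a * ⟪v, z⟫ * (s + ‖z‖ ^ 2) ^ (a - 1)) y = _ from
    (h1.mul (hasFDerivAt_add_norm_sq_rpow hs (a - 1) y)).fderiv]
  simp [real_inner_comm v y, sub_sub]
  norm_num
  ring

end RegularizedKernel

section Laplacian

variable {n : ℕ}

theorem laplacian_add_norm_sq_rpow {s : ℝ} (hs : 0 < s) (y : EuclideanSpace ℝ (Fin n)) :
    laplacian (fun y => (s + ‖y‖ ^ 2) ^ (1 - n / 2 : ℝ)) y =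
      (2 - n) * n * (s * (s + ‖y‖ ^ 2) ^ (-(n + 2) / 2 : ℝ)) := by
  have hR : 0 < s + ‖y‖ ^ 2 := by positivity
  have h1 : (s + ‖y‖ ^ 2) ^ ((1 - n / 2 : ℝ) - 1)
      = (s + ‖y‖ ^ 2) * (s + ‖y‖ ^ 2) ^ (-(n + 2) / 2 : ℝ) := by
    rw [mul_comm, ← Real.rpow_add_one hR.ne']
    ring_nf
  have h2 : ((1 - n / 2 : ℝ) - 2) = -(n + 2) / 2 - 0 := by ring
  have hn : ‖y‖ ^ 2 = ∑ i, y i ^ 2 := EuclideanSpace.real_norm_sq_eq y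
  simp only [laplacian, fderiv_fderiv_add_norm_sq_rpow_apply hs]
  rw [h1, ← Finset.mul_sum, Finset.sum_add_distrib, ← Finset.sum_mul]
  simp only [PiLp.norm_single, EuclideanSpace.inner_single_left, norm_one, one_pow, map_one,
    one_mul, Finset.sum_const, Finset.card_univ,
    Fintype.card_fin, nsmul_eq_mul, mul_one]
  rw [← Finset.sum_mul, ← Finset.mul_sum, ← hn, h2, sub_zero]
  ring

theorem ContDiff.continuous_laplacian {w : EuclideanSpace ℝ (Fin n) → ℝ} (hw : ContDiff ℝ 2 w) :
    Continuous (laplacian w) := by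
  refine continuous_finsetSum _ fun i _ => ?_
  have h : ContDiff ℝ 1 fun y => fderiv ℝ w y (EuclideanSpace.single i 1) :=
    (hw.fderiv_right (m := 1) (by norm_num)).clm_apply contDiff_const
  exact (h.continuous_fderiv one_ne_zero).clm_apply continuous_const

theorem Filter.EventuallyEq.laplacian_eq {u w : EuclideanSpace ℝ (Fin n) → ℝ}
    {x : EuclideanSpace ℝ (Fin n)} (h : u =ᶠ[𝓝 x] w) : laplacian u x = laplacian w x := by
  refine Finset.sum_congr rfl fun i _ => ?_
  have h' : (fun y => fderiv ℝ u y (EuclideanSpace.single i 1)) =ᶠ[𝓝 x]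
      fun y => fderiv ℝ w y (EuclideanSpace.single i 1) :=
    (h.fderiv (𝕜 := ℝ)).mono fun y hy => by simp only [hy]
  rw [h'.fderiv_eq]

theorem support_laplacian_subset (w : EuclideanSpace ℝ (Fin n) → ℝ) :
    Function.support (laplacian w) ⊆ tsupport w := fun x hx => by
  by_contra h
  have h0 : w =ᶠ[𝓝 x] fun _ => 0 := notMem_tsupport_iff_eventuallyEq.1 h
  refine hx ?_
  rw [h0.laplacian_eq]
  simp [laplacian]

theorem HasCompactSupport.laplacian {w : EuclideanSpace ℝ (Fin n) → ℝ}
    (hw : HasCompactSupport w) : HasCompactSupport (laplacian w) :=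
  hw.mono' (support_laplacian_subset w)

theorem laplacian_comp_add_right (w : EuclideanSpace ℝ (Fin n) → ℝ)
    (x y : EuclideanSpace ℝ (Fin n)) :
    laplacian (fun z => w (z + x)) y = laplacian w (y + x) := by
  simp only [laplacian, fderiv_comp_add_right]
  refine Finset.sum_congr rfl fun i _ => ?_
  rw [fderiv_comp_add_right (f := fun z => fderiv ℝ w z (EuclideanSpace.single i 1))]

/-- Green's second identity on the whole space for a compactly supported function. -/
theorem integral_mul_laplacian_eq {u w : EuclideanSpace ℝ (Fin n) → ℝ} (hu : ContDiff ℝ 2 u)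
    (hw : ContDiff ℝ 2 w) (hwc : HasCompactSupport w) :
    ∫ y, u y * laplacian w y = ∫ y, laplacian u y * w y := by
  have hD {g : EuclideanSpace ℝ (Fin n) → ℝ} (hg : ContDiff ℝ 2 g) (i : Fin n) :
      ContDiff ℝ 1 fun y => fderiv ℝ g y (EuclideanSpace.single i 1) :=
    (hg.fderiv_right (m := 1) (by norm_num)).clm_apply contDiff_const
  have hDD {g : EuclideanSpace ℝ (Fin n) → ℝ} (hg : ContDiff ℝ 1 g) (i : Fin n) :
      Continuous fun y => fderiv ℝ g y (EuclideanSpace.single i 1) :=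
    (hg.continuous_fderiv one_ne_zero).clm_apply continuous_const
  have hc {g : EuclideanSpace ℝ (Fin n) → ℝ} (hg : HasCompactSupport g) (i : Fin n) :
      HasCompactSupport fun y => fderiv ℝ g y (EuclideanSpace.single i 1) :=
    hg.fderiv_apply ℝ _
  have hint {g h : EuclideanSpace ℝ (Fin n) → ℝ} (hg : Continuous g) (hh : Continuous h)
      (hhc : HasCompactSupport h) : Integrable fun y => g y * h y :=
    (hg.mul hh).integrable_of_hasCompactSupport hhc.mul_left
  simp only [laplacian, Finset.mul_sum, Finset.sum_mul]
  rw [integral_finsetSum _ fun i _ => hint hu.continuous (hDD (hD hw i) i) (hc (hc hwc i) i),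
    integral_finsetSum _ fun i _ => hint (hDD (hD hu i) i) hw.continuous hwc]
  refine Finset.sum_congr rfl fun i _ => ?_
  rw [integral_mul_fderiv_eq_neg_fderiv_mul_of_integrable
      (hint (hD hu i).continuous (hD hw i).continuous (hc hwc i))
      (hint hu.continuous (hDD (hD hw i) i) (hc (hc hwc i) i))
      (hint hu.continuous (hD hw i).continuous (hc hwc i))
      (fun x _ => hu.differentiable two_ne_zero x)
      (fun x _ => (hD hw i).differentiable one_ne_zero x),
    integral_mul_fderiv_eq_neg_fderiv_mul_of_integrable
      (hint (hDD (hD hu i) i) hw.continuous hwc)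
      (hint (hD hu i).continuous (hD hw i).continuous (hc hwc i))
      (hint (hD hu i).continuous hw.continuous hwc)
      (fun x _ => (hD hu i).differentiable one_ne_zero x)
      (fun x _ => hw.differentiable two_ne_zero x), neg_neg]

theorem locallyIntegrable_norm_rpow (hn : 3 ≤ n) :
    LocallyIntegrable fun y : EuclideanSpace ℝ (Fin n) => ‖y‖ ^ (2 - n : ℝ) := by
  refine locallyIntegrable_of_norm_le_rpow (C := 1) (α := n - 2) (by simp; omega) (by simp)
    (.of_forall fun y => ?_) (measurable_norm.pow_const _).aestronglyMeasurable
  rw [Real.norm_of_nonneg (by positivity), one_mul, neg_sub]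

theorem tendsto_integral_regularized_kernel_mul (hn : 3 ≤ n)
    {h : EuclideanSpace ℝ (Fin n) → ℝ} (hh : Continuous h) (hhc : HasCompactSupport h) :
    Tendsto (fun ε : ℝ => ∫ y, (ε ^ 2 + ‖y‖ ^ 2) ^ (1 - n / 2 : ℝ) * h y) (𝓝[>] 0)
      (𝓝 (∫ y, ‖y‖ ^ (2 - n : ℝ) * h y)) := by
  have hn' : (3 : ℝ) ≤ n := by exact_mod_cast hn
  have : Nontrivial (EuclideanSpace ℝ (Fin n)) :=
    Module.nontrivial_of_finrank_pos (R := ℝ) (by simp; omega)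
  have hpow (y : EuclideanSpace ℝ (Fin n)) :
      ‖y‖ ^ (2 - n : ℝ) = (0 ^ 2 + ‖y‖ ^ 2) ^ (1 - n / 2 : ℝ) := by
    rw [zero_pow two_ne_zero, zero_add, ← Real.rpow_natCast, ← Real.rpow_mul (norm_nonneg y)]
    push_cast
    ring_nf
  have hne : ∀ᵐ y : EuclideanSpace ℝ (Fin n), y ≠ 0 := by
    simp [ae_iff]
  refine tendsto_integral_filter_of_dominated_convergence (fun y => ‖y‖ ^ (2 - n : ℝ) * |h y|)
    (.of_forall fun ε => ?_) (.of_forall fun ε => ?_) ?_ ?_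
  · have := hh.measurable
    exact Measurable.aestronglyMeasurable (by fun_prop)
  · filter_upwards [hne] with y hy
    have : 0 < ‖y‖ := norm_pos_iff.2 hy
    rw [norm_mul, Real.norm_of_nonneg (by positivity), Real.norm_eq_abs, hpow]
    refine mul_le_mul_of_nonneg_right
      (Real.rpow_le_rpow_of_nonpos (by positivity) ?_ (by linarith)) (abs_nonneg _)
    nlinarith [sq_nonneg ε]
  · exact (locallyIntegrable_norm_rpow hn).integrable_smul_right_of_hasCompactSupport hh.abs hhc.abs
  · filter_upwards [hne] with y hy
    have : 0 < ‖y‖ := norm_pos_iff.2 hy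
    rw [hpow]
    refine Tendsto.mul_const _ (Tendsto.mono_left ?_ nhdsWithin_le_nhds)
    have hc : ContinuousAt (fun ε : ℝ => (ε ^ 2 + ‖y‖ ^ 2) ^ (1 - n / 2 : ℝ)) 0 :=
      ContinuousAt.rpow_const (by fun_prop) (Or.inl (by positivity))
    exact hc

theorem tendsto_integral_approximate_identity_mul
    {w : EuclideanSpace ℝ (Fin n) → ℝ} (hw : Continuous w) (hwc : HasCompactSupport w) :
    Tendsto (fun ε : ℝ => ∫ y, (ε ^ 2 * (ε ^ 2 + ‖y‖ ^ 2) ^ (-(n + 2) / 2 : ℝ)) * w y) (𝓝[>] 0)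
      (𝓝 ((∫ y : EuclideanSpace ℝ (Fin n), (1 + ‖y‖ ^ 2) ^ (-(n + 2) / 2 : ℝ)) * w 0)) := by
  have hscale : ∀ ε : ℝ, 0 < ε →
      ∫ y, (ε ^ 2 * (ε ^ 2 + ‖y‖ ^ 2) ^ (-(n + 2) / 2 : ℝ)) * w y =
        ∫ y : EuclideanSpace ℝ (Fin n), (1 + ‖y‖ ^ 2) ^ (-(n + 2) / 2 : ℝ) * w (ε • y) := by
    intro ε hε
    have key := Measure.integral_comp_smul_of_nonneg (volume : Measure (EuclideanSpace ℝ (Fin n)))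
      (fun y => (ε ^ 2 * (ε ^ 2 + ‖y‖ ^ 2) ^ (-(n + 2) / 2 : ℝ)) * w y) ε (hR := hε.le)
    rw [finrank_euclideanSpace_fin, smul_eq_mul, inv_mul_eq_div, eq_div_iff (by positivity)] at key
    rw [← key, ← integral_mul_const]
    refine integral_congr_ae (.of_forall fun y => ?_)
    have h1 : (ε ^ 2 + ‖ε • y‖ ^ 2) ^ (-(n + 2) / 2 : ℝ)
        = (ε ^ (n + 2))⁻¹ * (1 + ‖y‖ ^ 2) ^ (-(n + 2) / 2 : ℝ) := by
      rw [norm_smul, Real.norm_of_nonneg hε.le,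
        show ε ^ 2 + (ε * ‖y‖) ^ 2 = ε ^ 2 * (1 + ‖y‖ ^ 2) by ring,
        Real.mul_rpow (by positivity) (by positivity), ← Real.rpow_natCast ε 2,
        ← Real.rpow_mul hε.le, ← Real.rpow_natCast ε (n + 2), ← Real.rpow_neg hε.le]
      push_cast
      ring_nf
    simp only [h1]
    field_simp
    ring
  obtain ⟨C, hC⟩ := hwc.exists_bound_of_continuous hw
  have hφ : Integrable fun y : EuclideanSpace ℝ (Fin n) => (1 + ‖y‖ ^ 2) ^ (-(n + 2) / 2 : ℝ) :=
    integrable_rpow_neg_one_add_norm_sq (by simp)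
  rw [← integral_mul_const]
  refine Tendsto.congr' (eventually_mem_nhdsWithin.mono fun ε hε => (hscale ε hε).symm) ?_
  refine tendsto_integral_filter_of_dominated_convergence
    (fun y => (1 + ‖y‖ ^ 2) ^ (-(n + 2) / 2 : ℝ) * C)
    (.of_forall fun ε => ?_) (.of_forall fun ε => .of_forall fun y => ?_) (hφ.mul_const C)
    (.of_forall fun y => ?_)
  · exact hφ.aestronglyMeasurable.mul
      (hw.comp (continuous_const_smul ε)).aestronglyMeasurable
  · rw [norm_mul, Real.norm_of_nonneg (by positivity)]
    exact mul_le_mul_of_nonneg_left (hC _) (by positivity)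
  · refine Tendsto.const_mul _ (Tendsto.mono_left ?_ nhdsWithin_le_nhds)
    have : ContinuousAt (fun ε : ℝ => w (ε • y)) 0 := by fun_prop
    simpa [ContinuousAt] using this

/-- Up to a constant factor, a compactly supported `C²` function is the Newtonian potential of its
Laplacian. -/
theorem exists_integral_fundSol_mul_laplacian_eq (hn : 3 ≤ n) :
    ∃ K : ℝ, ∀ w : EuclideanSpace ℝ (Fin n) → ℝ, ContDiff ℝ 2 w → HasCompactSupport w →
      ∀ x, ∫ y, fundSol n (y - x) * laplacian w y = K * w x := by
  refine ⟨fundConst n * ((2 - n) * n *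
    ∫ y : EuclideanSpace ℝ (Fin n), (1 + ‖y‖ ^ 2) ^ (-(n + 2) / 2 : ℝ)), fun w hw hwc x => ?_⟩
  have hw' : ContDiff ℝ 2 fun z => w (z + x) := hw.comp (contDiff_id.add contDiff_const)
  have hwc' : HasCompactSupport fun z => w (z + x) := hwc.comp_homeomorph (Homeomorph.addRight x)
  have h1 := tendsto_integral_regularized_kernel_mul hn hw'.continuous_laplacian hwc'.laplacian
  have h2 := (tendsto_integral_approximate_identity_mul hw'.continuous hwc').const_mul
    ((2 - n : ℝ) * n)
  have h3 := tendsto_nhds_unique (h1.congr' ?_) h2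
  · rw [← integral_add_right_eq_self _ x]
    simp only [fundSol, add_sub_cancel_right, mul_assoc, integral_const_mul]
    simp only [laplacian_comp_add_right, zero_add] at h3
    rw [h3]
    ring
  · filter_upwards [eventually_mem_nhdsWithin] with ε hε
    have hε' : (0 : ℝ) < ε ^ 2 := pow_pos hε 2
    rw [integral_mul_laplacian_eq (contDiff_add_norm_sq_rpow hε' _ _) hw' hwc',
      ← integral_const_mul]
    simp only [laplacian_add_norm_sq_rpow hε', mul_assoc]

theorem fundSol_neg (z : EuclideanSpace ℝ (Fin n)) : fundSol n (-z) = fundSol n z := by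
  simp [fundSol]

theorem contDiffAt_fundSol {k : WithTop ℕ∞} {z : EuclideanSpace ℝ (Fin n)} (hz : z ≠ 0) :
    ContDiffAt ℝ k (fundSol n) z :=
  contDiffAt_const.mul ((contDiffAt_norm ℝ hz).rpow_const_of_ne (norm_ne_zero_iff.2 hz))

theorem locallyIntegrable_fundSol (hn : 3 ≤ n) : LocallyIntegrable (fundSol n) :=
  (locallyIntegrable_norm_rpow hn).smul (fundConst n)

theorem integrable_fundSol_sub_mul (hn : 3 ≤ n) {h : EuclideanSpace ℝ (Fin n) → ℝ} {C R : ℝ}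
    (hh : AEStronglyMeasurable h) (hC : ∀ y, |h y| ≤ C)
    (hR : Function.support h ⊆ closedBall 0 R) (x : EuclideanSpace ℝ (Fin n)) :
    Integrable fun y => fundSol n (y - x) * h y := by
  have h1 : IntegrableOn (fun y => fundSol n (y - x)) (closedBall 0 R) := by
    have h0 := (locallyIntegrable_fundSol hn).integrableOn_isCompact
      (isCompact_closedBall (-x) R)
    rw [← (measurePreserving_sub_right volume x).integrableOn_comp_preimage
      (Homeomorph.subRight x).measurableEmbedding] at h0
    refine h0.mono_set fun y hy => ?_
    simpa [dist_eq_norm] using hy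
  refine (integrableOn_iff_integrable_of_support_subset (s := closedBall 0 R) ?_).1
    (h1.mul_bdd hh.restrict (.of_forall hC))
  exact (Function.support_mul_subset_right _ _).trans hR

/-- The potential of a bounded, boundedly supported density is smooth away from the density. -/
theorem contDiffAt_integral_fundSol_sub_mul {h : EuclideanSpace ℝ (Fin n) → ℝ}
    {C R r : ℝ} (hh : AEStronglyMeasurable h) (hC : ∀ y, |h y| ≤ C)
    (hR : Function.support h ⊆ closedBall 0 R) {x₀ : EuclideanSpace ℝ (Fin n)} (hr : 0 < r)
    (hzero : ∀ y ∈ ball x₀ r, h y = 0) :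
    ContDiffAt ℝ 2 (fun x => ∫ y, fundSol n (y - x) * h y) x₀ := by
  let b₁ : ContDiffBump (0 : EuclideanSpace ℝ (Fin n)) :=
    ⟨|R| + ‖x₀‖ + r, |R| + ‖x₀‖ + r + 1, by positivity, by linarith⟩
  let b₂ : ContDiffBump (0 : EuclideanSpace ℝ (Fin n)) :=
    ⟨r / 4, r / 2, by positivity, by linarith⟩
  let G : EuclideanSpace ℝ (Fin n) → ℝ := fun z => b₁ z * ((1 - b₂ z) * fundSol n z)
  have hG : ContDiff ℝ 2 G := by
    refine contDiff_iff_contDiffAt.2 fun z => b₁.contDiffAt.mul ?_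
    rcases eq_or_ne z 0 with rfl | hz
    · refine (contDiffAt_const (c := (0 : ℝ))).congr_of_eventuallyEq ?_
      filter_upwards [b₂.eventuallyEq_one] with z hz
      simp [hz]
    · exact (contDiffAt_const.sub b₂.contDiffAt).mul (contDiffAt_fundSol hz)
  have hGc : HasCompactSupport G := b₁.hasCompactSupport.mul_right
  have hint : Integrable h := by
    refine (integrableOn_iff_integrable_of_support_subset hR).1 ?_
    exact (integrableOn_const (C := C) measure_closedBall_lt_top.ne).mono' hh.restrict
      (.of_forall hC)
  have hconv := hGc.contDiff_convolution_right (n := 2) (ContinuousLinearMap.mul ℝ ℝ)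
    hint.locallyIntegrable hG
  refine hconv.contDiffAt.congr_of_eventuallyEq ?_
  filter_upwards [ball_mem_nhds x₀ (half_pos hr)] with x hx
  refine integral_congr_ae (.of_forall fun y => ?_)
  by_cases hy : h y = 0
  · simp [hy]
  have hyR : ‖y‖ ≤ R := by simpa using hR hy
  have hyr : r ≤ dist y x₀ := not_lt.1 fun hlt => hy (hzero y hlt)
  rw [mem_ball] at hx
  have hlow : r / 2 ≤ ‖x - y‖ := by
    rw [← dist_eq_norm]
    linarith [dist_triangle y x x₀, dist_comm x y]
  have hup : ‖x - y‖ ≤ |R| + ‖x₀‖ + r := by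
    rw [dist_eq_norm] at hx
    linarith [norm_sub_le x y, norm_le_norm_add_norm_sub x₀ x, le_abs_self R, norm_sub_rev x x₀]
  have hb₁ : b₁ (x - y) = 1 := b₁.one_of_mem_closedBall (by simpa using hup)
  have hb₂ : b₂ (x - y) = 0 := b₂.zero_of_le_dist (by simpa using hlow)
  simp [G, hb₁, hb₂, ← fundSol_neg (y - x), mul_comm]

end Laplacian

/-- if the Poisson equation `Δv = -f` has a classical solution
`v ∈ C²(Ω,ℝ)`, then the Newtonian potential `u_f` is of class `C²` on `Ω`. -/
theorem newtonianPotential_contDiffOn_of_classical_solution {n : ℕ} (hn : 3 ≤ n)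
    (Ω : Set (EuclideanSpace ℝ (Fin n))) (hΩopen : IsOpen Ω)
    (hΩbdd : Bornology.IsBounded Ω)
    (f : EuclideanSpace ℝ (Fin n) → ℝ) (hfcont : ContinuousOn f Ω)
    (hfbdd : ∃ C : ℝ, ∀ x ∈ Ω, |f x| ≤ C)
    (hsol : ∃ v : EuclideanSpace ℝ (Fin n) → ℝ,
      ContDiffOn ℝ 2 v Ω ∧ ∀ x ∈ Ω, laplacian v x = -f x) :
    ContDiffOn ℝ 2 (newtonianPotential Ω f) Ω := by
  obtain ⟨C, hC⟩ := hfbdd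
  obtain ⟨v, hv, hΔ⟩ := hsol
  obtain ⟨K, hK⟩ := exists_integral_fundSol_mul_laplacian_eq hn
  intro x₀ hx₀
  refine ContDiffAt.contDiffWithinAt ?_
  obtain ⟨δ, hδ, hball⟩ := Metric.isOpen_iff.1 hΩopen x₀ hx₀
  let χ : ContDiffBump x₀ := ⟨δ / 4, δ / 2, by positivity, by linarith⟩
  let w : EuclideanSpace ℝ (Fin n) → ℝ := fun y => χ y * v y
  have hχΩ : tsupport χ ⊆ Ω := by
    rw [χ.tsupport_eq]
    exact (closedBall_subset_ball (by change δ / 2 < δ; linarith)).trans hball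
  have hw : ContDiff ℝ 2 w := by
    refine contDiff_iff_contDiffAt.2 fun y => ?_
    by_cases hy : y ∈ Ω
    · exact χ.contDiffAt.mul (hv.contDiffAt (hΩopen.mem_nhds hy))
    · refine (contDiffAt_const (c := (0 : ℝ))).congr_of_eventuallyEq ?_
      filter_upwards [notMem_tsupport_iff_eventuallyEq.1 fun h => hy (hχΩ h)] with z hz
      simp [w, hz]
  have hwc : HasCompactSupport w := χ.hasCompactSupport.mul_right
  have hwΔ : ∀ y ∈ ball x₀ (δ / 4), laplacian w y = -f y := fun y hy => by
    rw [← hΔ y (hball (ball_subset_ball (by linarith) hy))]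
    refine Filter.EventuallyEq.laplacian_eq ?_
    filter_upwards [χ.eventuallyEq_one_of_mem_ball hy] with z hz
    simp [w, hz]
  have hΔc := hw.continuous_laplacian
  obtain ⟨C', hC'⟩ := hwc.laplacian.exists_bound_of_continuous hΔc
  obtain ⟨R, hR⟩ := hΩbdd.subset_closedBall 0
  have hw_supp : Function.support (laplacian w) ⊆ Ω :=
    (support_laplacian_subset w).trans ((tsupport_mul_subset_left (f := χ)).trans hχΩ)
  let h : EuclideanSpace ℝ (Fin n) → ℝ := fun y => Ω.indicator f y + laplacian w y
  have hh : AEStronglyMeasurable h :=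
    ((aestronglyMeasurable_indicator_iff hΩopen.measurableSet).2
      (hfcont.aestronglyMeasurable hΩopen.measurableSet)).add hΔc.aestronglyMeasurable
  have hhC : ∀ y, |h y| ≤ |C| + C' := fun y => by
    refine (abs_add_le _ _).trans (add_le_add ?_ (hC' y))
    by_cases hy : y ∈ Ω
    · simpa [hy] using (hC y hy).trans (le_abs_self C)
    · simp [hy]
  have hhR : Function.support h ⊆ closedBall 0 R :=
    (Function.support_add _ _).trans
      (Set.union_subset Set.support_indicator_subset hw_supp) |>.trans hR
  have hhzero : ∀ y ∈ ball x₀ (δ / 4), h y = 0 := fun y hy => by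
    simp [h, hwΔ y hy, hball (ball_subset_ball (by linarith) hy)]
  have hpot : newtonianPotential Ω f =
      fun x => (∫ y, fundSol n (y - x) * h y) - K * w x := by
    funext x
    rw [← hK w hw hwc x, ← integral_sub (integrable_fundSol_sub_mul hn hh hhC hhR x)
      (integrable_fundSol_sub_mul hn hΔc.aestronglyMeasurable hC' (hw_supp.trans hR) x),
      newtonianPotential, ← integral_indicator hΩopen.measurableSet]
    refine integral_congr_ae (.of_forall fun y => ?_)
    by_cases hy : y ∈ Ω <;> simp [h, hy, mul_add]
  rw [hpot]
  exact (contDiffAt_integral_fundSol_sub_mul hh hhC hhR (by positivity) hhzero).sub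
    (contDiffAt_const.mul hw.contDiffAt)
end

section
/- (Pizzetti's Theorem) Let n ≥ 3, let Ω ⊆ ℝⁿ be a bounded open set, and let f : Ω → ℝ be a bounded continuous function. Then for every x ∈ Ω the limit as r → 0⁺ of 2(n+2) · ((1/|B(x,r)|) ∫_{B(x,r)} u_f(y) dy − u_f(x)) / r² exists and equals −f(x); that is, the asymptotic average Laplacian of the Newtonian potential u_f equals −f at every point of Ω. -/
open MeasureTheory Filter Topology Metric

open scoped RealInnerProductSpace

section NormRpow

variable {E : Type*} [NormedAddCommGroup E] [InnerProductSpace ℝ E]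

theorem HasDerivAt.norm_rpow_const {q : ℝ → E} {q' : E} {t : ℝ} (hq : HasDerivAt q q' t)
    (h0 : q t ≠ 0) (a : ℝ) :
    HasDerivAt (fun s => ‖q s‖ ^ a) (a * ‖q t‖ ^ (a - 2) * ⟪q t, q'⟫) t := by
  have hpos : 0 < ‖q t‖ := norm_pos_iff.mpr h0
  have key : ∀ (x b : ℝ), 0 ≤ x → (x ^ 2) ^ (b / 2) = x ^ b := fun x b hx => by
    rw [← Real.rpow_natCast, ← Real.rpow_mul hx]
    congr 1
    push_cast
    ring
  have h := hq.norm_sq.rpow_const (p := a / 2) (Or.inl (by positivity))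
  have e : a / 2 - 1 = (a - 2) / 2 := by ring
  rw [e, key _ _ hpos.le] at h
  simp only [key _ _ (norm_nonneg _)] at h
  convert h using 1
  ring

theorem contDiffOn_norm_rpow_sub_smul {w : E} {r : ℝ} {s : Set E}
    (h : ∀ z ∈ s, w - r • z ≠ 0) (a : ℝ) :
    ContDiffOn ℝ 1 (fun z => ‖w - r • z‖ ^ a) s := fun z hz =>
  (((contDiffAt_const.sub (contDiffAt_const.smul contDiffAt_id)).norm ℝ (h z hz)).rpow_const_of_ne
    (norm_ne_zero_iff.mpr (h z hz))).contDiffWithinAt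

end NormRpow

section IntegrationByParts

variable {E : Type*} [NormedAddCommGroup E]

/-- The Lipschitz function equal to `1 - ‖z‖ ^ 2` on the unit ball and to `0` outside it. -/
noncomputable def paraboloidCap (z : E) : ℝ := 1 - (min ‖z‖ 1) ^ 2

theorem paraboloidCap_of_norm_le {z : E} (hz : ‖z‖ ≤ 1) : paraboloidCap z = 1 - ‖z‖ ^ 2 := by
  simp [paraboloidCap, hz]

theorem paraboloidCap_of_le_norm {z : E} (hz : 1 ≤ ‖z‖) : paraboloidCap z = 0 := by
  simp [paraboloidCap, hz]

theorem lipschitzWith_paraboloidCap : LipschitzWith 2 (paraboloidCap : E → ℝ) := by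
  refine LipschitzWith.of_dist_le_mul fun a b => ?_
  have h1 : |min ‖b‖ 1 - min ‖a‖ 1| ≤ ‖a - b‖ := by
    have := abs_min_sub_min_le_max ‖b‖ 1 ‖a‖ 1
    have h2 := abs_norm_sub_norm_le b a
    rw [norm_sub_rev] at h2
    simp only [sub_self, abs_zero, max_eq_left (abs_nonneg (‖b‖ - ‖a‖))] at this
    exact this.trans h2
  have h2 : |min ‖b‖ 1 + min ‖a‖ 1| ≤ 2 := by
    rw [abs_of_nonneg (by positivity)]
    linarith [min_le_right ‖b‖ 1, min_le_right ‖a‖ 1]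
  have e : paraboloidCap a - paraboloidCap b
      = (min ‖b‖ 1 + min ‖a‖ 1) * (min ‖b‖ 1 - min ‖a‖ 1) := by
    simp only [paraboloidCap]
    ring
  rw [Real.dist_eq, dist_eq_norm, e, abs_mul]
  exact mul_le_mul h2 h1 (abs_nonneg _) zero_le_two

variable [InnerProductSpace ℝ E]

theorem lineDeriv_paraboloidCap_of_norm_lt {z : E} (hz : ‖z‖ < 1) (v : E) :
    lineDeriv ℝ paraboloidCap z v = -(2 * ⟪z, v⟫) := by
  have hev : (paraboloidCap : E → ℝ) =ᶠ[𝓝 z] fun y => 1 - ‖y‖ ^ 2 := by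
    filter_upwards [(isOpen_lt continuous_norm continuous_const).mem_nhds hz] with y hy
    exact paraboloidCap_of_norm_le (le_of_lt hy)
  rw [hev.lineDeriv_eq]
  apply HasLineDerivAt.lineDeriv
  have h : HasDerivAt (fun t : ℝ => z + t • v) v 0 := by
    simpa using ((hasDerivAt_id (0 : ℝ)).smul_const v).const_add z
  simpa [HasLineDerivAt] using h.norm_sq.const_sub 1

theorem lineDeriv_paraboloidCap_of_lt_norm {z : E} (hz : 1 < ‖z‖) (v : E) :
    lineDeriv ℝ paraboloidCap z v = 0 := by
  have hev : (paraboloidCap : E → ℝ) =ᶠ[𝓝 z] fun _ => 0 := by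
    filter_upwards [(isOpen_lt continuous_const continuous_norm).mem_nhds hz] with y hy
    exact paraboloidCap_of_le_norm (le_of_lt hy)
  rw [hev.lineDeriv_eq]
  simp [lineDeriv]

variable [FiniteDimensional ℝ E]

theorem hasCompactSupport_paraboloidCap : HasCompactSupport (paraboloidCap : E → ℝ) := by
  refine HasCompactSupport.intro (isCompact_closedBall (0 : E) 1) fun z hz => ?_
  apply paraboloidCap_of_le_norm
  simpa using (not_le.mp (by simpa using hz)).le

variable [MeasurableSpace E] [BorelSpace E] (μ : Measure E) [μ.IsAddHaarMeasure]

theorem setIntegral_ball_two_mul_inner_mul {h : E → ℝ} {R : ℝ} (hR : 1 < R)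
    (hh : ContDiffOn ℝ 1 h (ball 0 R)) (v : E) :
    ∫ z in ball (0 : E) 1, 2 * ⟪z, v⟫ * h z ∂μ
      = ∫ z in ball (0 : E) 1, (1 - ‖z‖ ^ 2) * lineDeriv ℝ h z v ∂μ := by
  rcases subsingleton_or_nontrivial E with hE | hE
  · simp [Subsingleton.elim v 0, lineDeriv]
  let χ : ContDiffBump (0 : E) :=
    ⟨1 + (R - 1) / 3, 1 + 2 * (R - 1) / 3, by linarith, by linarith⟩
  have hχball : ∀ z ∈ ball (0 : E) 1, χ =ᶠ[𝓝 z] 1 := fun z hz =>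
    χ.eventuallyEq_one_of_mem_ball (ball_subset_ball (by simp only [χ]; linarith) hz)
  let g : E → ℝ := fun z => χ z * h z
  have hts : tsupport χ ⊆ ball (0 : E) R := by
    rw [χ.tsupport_eq]
    exact closedBall_subset_ball (by simp only [χ]; linarith)
  have hgc : HasCompactSupport g := χ.hasCompactSupport.mul_right
  have hgd : ContDiff ℝ 1 g := by
    refine contDiff_iff_contDiffAt.mpr fun z => ?_
    by_cases hz : z ∈ tsupport χ
    · exact χ.contDiff.contDiffAt.mul (hh.contDiffAt (isOpen_ball.mem_nhds (hts hz)))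
    · have h0 : g =ᶠ[𝓝 z] fun _ => 0 := by
        filter_upwards [notMem_tsupport_iff_eventuallyEq.mp hz] with y hy
        simp [g, hy]
      exact contDiffAt_const.congr_of_eventuallyEq h0
  obtain ⟨C, hC⟩ := hgd.lipschitzWith_of_hasCompactSupport hgc one_ne_zero
  have hgh : ∀ z ∈ ball (0 : E) 1, g =ᶠ[𝓝 z] h := fun z hz => by
    filter_upwards [hχball z hz] with y hy
    simp [g, hy]
  have key := hC.integral_lineDeriv_mul_eq (μ := μ) lipschitzWith_paraboloidCap
    hasCompactSupport_paraboloidCap v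
  rw [← integral_indicator measurableSet_ball, ← integral_indicator measurableSet_ball]
  have hnull : ∀ᵐ z ∂μ, z ∉ sphere (0 : E) 1 :=
    measure_eq_zero_iff_ae_notMem.mp (Measure.addHaar_sphere μ 0 1)
  calc _ = ∫ z, lineDeriv ℝ paraboloidCap z (-v) * g z ∂μ := by
        refine integral_congr_ae ?_
        filter_upwards [hnull] with z hz
        by_cases hzb : z ∈ ball (0 : E) 1
        · rw [Set.indicator_of_mem hzb, (hgh z hzb).self_of_nhds,
            lineDeriv_paraboloidCap_of_norm_lt (by simpa using hzb)]
          simp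
        · rw [Set.indicator_of_notMem hzb, lineDeriv_paraboloidCap_of_lt_norm, zero_mul]
          simp only [mem_ball, mem_sphere, dist_zero_right] at hz hzb
          exact lt_of_le_of_ne (not_lt.mp hzb) (Ne.symm hz)
    _ = ∫ z, lineDeriv ℝ g z v * paraboloidCap z ∂μ := key.symm
    _ = _ := by
        refine integral_congr_ae (Eventually.of_forall fun z => ?_)
        by_cases hzb : z ∈ ball (0 : E) 1
        · simp only [Set.indicator_of_mem hzb]
          rw [(hgh z hzb).lineDeriv_eq, paraboloidCap_of_norm_le (by simpa using (mem_ball.mp hzb).le)]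
          ring
        · simp only [Set.indicator_of_notMem hzb]
          rw [paraboloidCap_of_le_norm (by simpa using hzb), mul_zero]

end IntegrationByParts

section Euclidean

variable {n : ℕ}

local notation "𝔼" => EuclideanSpace ℝ (Fin n)

theorem sub_smul_ne_zero_of_abs_mul_norm_lt {E : Type*} [NormedAddCommGroup E] [NormedSpace ℝ E]
    {w z : E} {r : ℝ} (h : |r| * ‖z‖ < ‖w‖) : w - r • z ≠ 0 := by
  intro h0
  rw [sub_eq_zero] at h0
  rw [h0, norm_smul, Real.norm_eq_abs] at h
  exact lt_irrefl _ h

theorem setIntegral_ball_norm_rpow_mul_inner {w : 𝔼} {r : ℝ} (hr : |r| < ‖w‖) :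
    ∫ z in ball (0 : 𝔼) 1, ‖w - r • z‖ ^ (-(n : ℝ)) * ⟪w - r • z, z⟫ = 0 := by
  obtain ⟨R, hR, hrR⟩ : ∃ R : ℝ, 1 < R ∧ |r| * R < ‖w‖ := by
    have h0 := abs_nonneg r
    refine ⟨1 + (‖w‖ - |r|) / (|r| + 1), by
      have : 0 < (‖w‖ - |r|) / (|r| + 1) := div_pos (by linarith) (by linarith)
      linarith, ?_⟩
    have : |r| * ((‖w‖ - |r|) / (|r| + 1)) < ‖w‖ - |r| := by
      rw [mul_div_assoc', div_lt_iff₀ (by linarith)]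
      nlinarith
    linarith
  have hne : ∀ z ∈ ball (0 : 𝔼) R, w - r • z ≠ 0 := fun z hz => by
    refine sub_smul_ne_zero_of_abs_mul_norm_lt (lt_of_le_of_lt ?_ hrR)
    exact mul_le_mul_of_nonneg_left (by simpa using (mem_ball.mp hz).le) (abs_nonneg r)
  have hcont : ∀ a : ℝ, ContinuousOn (fun z => ‖w - r • z‖ ^ a) (ball (0 : 𝔼) R) := fun a =>
    (contDiffOn_norm_rpow_sub_smul hne a).continuousOn
  have hF_int : ∀ F : 𝔼 → ℝ, ContinuousOn F (ball (0 : 𝔼) R) → IntegrableOn F (ball (0 : 𝔼) 1) :=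
    fun F hF => ((hF.mono (closedBall_subset_ball hR)).integrableOn_compact
      (isCompact_closedBall 0 1)).mono_set ball_subset_closedBall
  let h : Fin n → 𝔼 → ℝ := fun i z => ‖w - r • z‖ ^ (-(n : ℝ)) * (w - r • z) i
  let d : Fin n → 𝔼 → ℝ := fun i z =>
    (n * ‖w - r • z‖ ^ (-(n : ℝ) - 2) * ((w - r • z) i) ^ 2 - ‖w - r • z‖ ^ (-(n : ℝ))) * r
  let e : Fin n → 𝔼 := fun i => EuclideanSpace.single i 1
  have hcoord : ∀ i, ContDiff ℝ 1 (fun z : 𝔼 => (w - r • z) i) := fun i => by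
    simp only [PiLp.sub_apply, PiLp.smul_apply]
    fun_prop
  have hhd : ∀ i, ContDiffOn ℝ 1 (h i) (ball (0 : 𝔼) R) := fun i =>
    (contDiffOn_norm_rpow_sub_smul hne _).mul (hcoord i).contDiffOn
  have hdc : ∀ i, ContinuousOn (d i) (ball (0 : 𝔼) R) := fun i =>
    (((continuousOn_const.mul (hcont _)).mul ((hcoord i).continuous.continuousOn.pow 2)).sub
      (hcont _)).mul continuousOn_const
  have hline : ∀ i, ∀ z ∈ ball (0 : 𝔼) R, lineDeriv ℝ (h i) z (e i) = d i z := fun i z hz => by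
    apply HasLineDerivAt.lineDeriv
    have hp : HasDerivAt (fun t : ℝ => w - r • (z + t • e i)) (-(r • e i)) 0 := by
      simpa using ((((hasDerivAt_id (0 : ℝ)).smul_const (e i)).const_add z).const_smul r).const_sub w
    have hpi : HasDerivAt (fun t : ℝ => (w - r • (z + t • e i)) i) (-r) 0 := by
      have := ((((hasDerivAt_id (0 : ℝ)).const_add (z i)).const_mul r).const_sub (w i))
      simpa [e, mul_add] using this
    have := (hp.norm_rpow_const (by simpa using hne z hz) (-(n : ℝ))).mul hpi
    simp only [HasLineDerivAt, h, d]
    convert! this using 1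
    simp [e, inner_neg_right, inner_smul_right, EuclideanSpace.inner_single_right]
    ring
  have hsub : ball (0 : 𝔼) 1 ⊆ ball 0 R := ball_subset_ball hR.le
  have key : ∀ i, ∫ z in ball (0 : 𝔼) 1, 2 * ⟪z, e i⟫ * h i z
      = ∫ z in ball (0 : 𝔼) 1, (1 - ‖z‖ ^ 2) * d i z := fun i => by
    rw [setIntegral_ball_two_mul_inner_mul volume hR (hhd i)]
    exact setIntegral_congr_fun measurableSet_ball fun z hz => by rw [hline i z (hsub hz)]
  have hsum := Finset.sum_congr (rfl : (Finset.univ : Finset (Fin n)) = _) fun i _ => key i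
  have hleft_int : ∀ i, IntegrableOn (fun z : 𝔼 => 2 * ⟪z, e i⟫ * h i z) (ball 0 1) := fun i =>
    hF_int _ (ContinuousOn.mul (by fun_prop) (hhd i).continuousOn)
  have hright_int : ∀ i, IntegrableOn (fun z : 𝔼 => (1 - ‖z‖ ^ 2) * d i z) (ball 0 1) := fun i =>
    hF_int _ (ContinuousOn.mul (by fun_prop) (hdc i))
  rw [← integral_finsetSum _ fun i _ => hleft_int i,
    ← integral_finsetSum _ fun i _ => hright_int i] at hsum
  have hl : ∀ z : 𝔼, ∑ i, 2 * ⟪z, e i⟫ * h i z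
      = 2 * (‖w - r • z‖ ^ (-(n : ℝ)) * ⟪w - r • z, z⟫) := fun z => by
    rw [PiLp.inner_apply, Finset.mul_sum, Finset.mul_sum]
    refine Finset.sum_congr rfl fun i _ => ?_
    simp [e, h, EuclideanSpace.inner_single_right]
    ring
  have hd : ∀ z ∈ ball (0 : 𝔼) 1, ∑ i, (1 - ‖z‖ ^ 2) * d i z = 0 := fun z hz => by
    have hpos := norm_pos_iff.mpr (hne z (hsub hz))
    have hpow : ‖w - r • z‖ ^ (-(n : ℝ) - 2) * ‖w - r • z‖ ^ 2 = ‖w - r • z‖ ^ (-(n : ℝ)) := by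
      rw [← Real.rpow_natCast, ← Real.rpow_add hpos]
      congr 1
      push_cast
      ring
    rw [← Finset.mul_sum, ← Finset.sum_mul, Finset.sum_sub_distrib, ← Finset.mul_sum,
      ← EuclideanSpace.real_norm_sq_eq, mul_assoc, hpow]
    simp
  rw [setIntegral_congr_fun measurableSet_ball hd] at hsum
  simp only [hl, integral_const_mul, integral_zero] at hsum
  linarith

theorem hasDerivAt_setIntegral_ball_norm_sub_smul_rpow {w : 𝔼} {r : ℝ} (hr : |r| < ‖w‖) :
    HasDerivAt (fun s : ℝ => ∫ z in ball (0 : 𝔼) 1, ‖w - s • z‖ ^ ((2 : ℝ) - n)) 0 r := by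
  obtain ⟨δ, hδ, hδr⟩ : ∃ δ > 0, |r| + δ + δ = ‖w‖ := ⟨(‖w‖ - |r|) / 2, by linarith, by ring⟩
  have hlow : ∀ t ∈ ball r δ, ∀ z ∈ ball (0 : 𝔼) 1, δ ≤ ‖w - t • z‖ ∧ ‖w - t • z‖ ≤ 2 * ‖w‖ := by
    intro t ht z hz
    have ht' : |t| ≤ |r| + δ := by
      have h1 : |t - r| < δ := by simpa [Real.dist_eq] using ht
      have h2 := abs_sub_abs_le_abs_sub t r
      linarith
    have hz' : ‖z‖ < 1 := by simpa using hz
    have htz : ‖t • z‖ ≤ |r| + δ := by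
      rw [norm_smul, Real.norm_eq_abs]
      nlinarith [abs_nonneg t, norm_nonneg z]
    constructor
    · have := norm_sub_norm_le w (t • z)
      linarith
    · have := norm_sub_le w (t • z)
      linarith
  let F' : ℝ → 𝔼 → ℝ := fun t z =>
    ((2 : ℝ) - n) * ‖w - t • z‖ ^ ((2 : ℝ) - n - 2) * ⟪w - t • z, -z⟫
  have hF_int : IntegrableOn (fun z : 𝔼 => ‖w - r • z‖ ^ ((2 : ℝ) - n)) (ball 0 1) := by
    refine ((contDiffOn_norm_rpow_sub_smul (s := closedBall (0 : 𝔼) 1) (fun z hz => ?_)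
      _).continuousOn.integrableOn_compact (isCompact_closedBall 0 1)).mono_set
      ball_subset_closedBall
    refine sub_smul_ne_zero_of_abs_mul_norm_lt (lt_of_le_of_lt ?_ hr)
    exact mul_le_of_le_one_right (abs_nonneg r) (by simpa using hz)
  have h := hasDerivAt_integral_of_dominated_loc_of_deriv_le (μ := volume.restrict (ball (0 : 𝔼) 1))
    (F := fun (t : ℝ) (z : 𝔼) => ‖w - t • z‖ ^ ((2 : ℝ) - n)) (F' := F') (x₀ := r)
    (bound := fun _ => |(2 : ℝ) - n| * δ ^ ((2 : ℝ) - n - 2) * (2 * ‖w‖))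
    (ball_mem_nhds r hδ)
    (Eventually.of_forall fun t =>
      (by fun_prop : Measurable fun z : 𝔼 => ‖w - t • z‖ ^ ((2 : ℝ) - n)).aestronglyMeasurable)
    hF_int
    (by
      have : Measurable (F' r) := by fun_prop
      exact this.aestronglyMeasurable)
    ((ae_restrict_mem measurableSet_ball).mono fun z hz t ht => by
      obtain ⟨h1, h2⟩ := hlow t ht z hz
      have hz' : ‖z‖ ≤ 1 := by simpa using (mem_ball.mp hz).le
      simp only [F', norm_mul, Real.norm_eq_abs]
      gcongr
      · rw [abs_of_nonneg (by positivity)]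
        refine Real.rpow_le_rpow_of_nonpos hδ h1 ?_
        have : (0 : ℝ) ≤ n := n.cast_nonneg
        linarith
      · refine (abs_real_inner_le_norm _ _).trans ?_
        rw [norm_neg]
        nlinarith [norm_nonneg z, norm_nonneg (w - t • z)])
    (integrableOn_const (by finiteness))
    ((ae_restrict_mem measurableSet_ball).mono fun z hz t ht => by
      have hne : w - t • z ≠ 0 := norm_pos_iff.mp (hδ.trans_le (hlow t ht z hz).1)
      have hp : HasDerivAt (fun t : ℝ => w - t • z) (-z) t := by
        simpa using ((hasDerivAt_id t).smul_const z).const_sub w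
      exact hp.norm_rpow_const hne _)
  have hzero : ∫ z in ball (0 : 𝔼) 1, F' r z = 0 := by
    have e : ∀ z : 𝔼, F' r z = ((n : ℝ) - 2) * (‖w - r • z‖ ^ (-(n : ℝ)) * ⟪w - r • z, z⟫) :=
      fun z => by
        simp only [F', inner_neg_right, show (2 : ℝ) - n - 2 = -n by ring]
        ring
    simp only [e, integral_const_mul, setIntegral_ball_norm_rpow_mul_inner hr, mul_zero]
  simpa [hzero] using h.2

theorem setIntegral_ball_norm_sub_smul_rpow {w : 𝔼} {s : ℝ} (hs : 0 ≤ s) (hsw : s < ‖w‖) :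
    ∫ z in ball (0 : 𝔼) 1, ‖w - s • z‖ ^ ((2 : ℝ) - n)
      = volume.real (ball (0 : 𝔼) 1) * ‖w‖ ^ ((2 : ℝ) - n) := by
  have hd : ∀ r ∈ Set.Icc 0 s, HasDerivAt
      (fun s : ℝ => ∫ z in ball (0 : 𝔼) 1, ‖w - s • z‖ ^ ((2 : ℝ) - n)) 0 r := fun r hr =>
    hasDerivAt_setIntegral_ball_norm_sub_smul_rpow
      (by rw [abs_of_nonneg hr.1]; exact hr.2.trans_lt hsw)
  have h := constant_of_has_deriv_right_zero
    (fun r hr => (hd r hr).continuousAt.continuousWithinAt)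
    (fun r hr => (hd r ⟨hr.1, hr.2.le⟩).hasDerivWithinAt) s ⟨hs, le_rfl⟩
  simpa using h

theorem integrableOn_ball_norm_rpow (hn : 0 < n) {a : ℝ} (ha : 0 < n + a) (R : ℝ) :
    IntegrableOn (fun z : 𝔼 => ‖z‖ ^ a) (ball 0 R) := by
  have : Nontrivial 𝔼 := Module.nontrivial_of_finrank_pos (R := ℝ) (by simpa using hn)
  rcases le_or_gt R 0 with hR | hR
  · simp [ball_eq_empty.mpr hR]
  rw [integrableOn_fun_norm_addHaar volume (f := fun y : ℝ => y ^ a)]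
  refine ((intervalIntegral.integrableOn_Ioo_rpow_iff (s := n - 1 + a) hR).mpr
    (by linarith)).congr_fun (fun y hy => ?_) measurableSet_Ioo
  simp only [finrank_euclideanSpace, Fintype.card_fin, smul_eq_mul]
  rw [Real.rpow_add hy.1, ← Real.rpow_natCast, Nat.cast_pred hn]

theorem setIntegral_ball_norm_rpow (hn : 0 < n) {a : ℝ} (ha : 0 < n + a) :
    ∫ z in ball (0 : 𝔼) 1, ‖z‖ ^ a = n * volume.real (ball (0 : 𝔼) 1) / (n + a) := by
  have : Nontrivial 𝔼 := Module.nontrivial_of_finrank_pos (R := ℝ) (by simpa using hn)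
  have h := integral_fun_norm_addHaar (volume : Measure 𝔼)
    (Set.indicator (Set.Iio 1) fun y : ℝ => y ^ a)
  have hl : ∀ z : 𝔼, Set.indicator (Set.Iio 1) (fun y : ℝ => y ^ a) ‖z‖
      = (ball (0 : 𝔼) 1).indicator (fun z => ‖z‖ ^ a) z := fun z => by
    simp [Set.indicator]
  have hr : ∀ y : ℝ, y ^ (n - 1) • Set.indicator (Set.Iio 1) (fun y : ℝ => y ^ a) y
      = Set.indicator (Set.Iio 1) (fun y : ℝ => y ^ (n - 1) * y ^ a) y := fun y => by
    simp [Set.indicator]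
  have hpow : ∫ y in Set.Ioo (0 : ℝ) 1, y ^ (n - 1) * y ^ a = 1 / (n + a) := by
    have e : ∀ y ∈ Set.Ioo (0 : ℝ) 1, y ^ (n - 1) * y ^ a = y ^ ((n : ℝ) - 1 + a) := fun y hy => by
      rw [Real.rpow_add hy.1, ← Real.rpow_natCast, Nat.cast_pred hn]
    rw [setIntegral_congr_fun measurableSet_Ioo e, ← integral_Ioc_eq_integral_Ioo,
      ← intervalIntegral.integral_of_le zero_le_one, integral_rpow (Or.inl (by linarith))]
    have h1 : (n : ℝ) - 1 + a + 1 = n + a := by ring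
    simp [h1, Real.zero_rpow ha.ne']
  simp only [hl, hr, finrank_euclideanSpace, Fintype.card_fin] at h
  rw [integral_indicator measurableSet_ball, setIntegral_indicator measurableSet_Iio,
    Set.Ioi_inter_Iio, hpow] at h
  rw [h]
  simp
  ring

theorem integrableOn_ball_norm_sub_rpow (hn : 0 < n) {a : ℝ} (ha : 0 < n + a) (w : 𝔼) (R : ℝ) :
    IntegrableOn (fun z : 𝔼 => ‖w - z‖ ^ a) (ball 0 R) := by
  have h := ((integrableOn_ball_norm_rpow hn ha (‖w‖ + R)).integrable_indicator
    measurableSet_ball).comp_sub_left w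
  refine (h.integrableOn (s := ball 0 R)).congr_fun (fun z hz => ?_) measurableSet_ball
  refine Set.indicator_of_mem (s := ball (0 : 𝔼) (‖w‖ + R)) (f := fun z => ‖z‖ ^ a) ?_
  simp only [mem_ball, dist_zero_right] at hz ⊢
  exact (norm_sub_le _ _).trans_lt (by linarith)

theorem setIntegral_ball_norm_sub_rpow (hn : 0 < n) {w : 𝔼} {s : ℝ} (hs : 0 < s) (hsw : s ≤ ‖w‖) :
    ∫ z in ball (0 : 𝔼) s, ‖w - z‖ ^ ((2 : ℝ) - n)
      = volume.real (ball (0 : 𝔼) 1) * s ^ n * ‖w‖ ^ ((2 : ℝ) - n) := by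
  have hlt : ∀ t, 0 < t → t < ‖w‖ → ∫ z in ball (0 : 𝔼) t, ‖w - z‖ ^ ((2 : ℝ) - n)
      = volume.real (ball (0 : 𝔼) 1) * t ^ n * ‖w‖ ^ ((2 : ℝ) - n) := fun t ht htw => by
    have h := Measure.setIntegral_comp_smul_of_pos (volume : Measure 𝔼)
      (fun z => ‖w - z‖ ^ ((2 : ℝ) - n)) (ball 0 1) ht
    rw [setIntegral_ball_norm_sub_smul_rpow ht.le htw, smul_unitBall_of_pos ht,
      finrank_euclideanSpace, Fintype.card_fin, smul_eq_mul] at h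
    have := pow_pos ht n
    field_simp at h
    linarith
  obtain ⟨u, hu_mono, hu_mem, hu_lim⟩ := exists_seq_strictMono_tendsto' hs
  have hunion : ⋃ k, ball (0 : 𝔼) (u k) = ball 0 s := by
    ext z
    simp only [Set.mem_iUnion, mem_ball]
    exact ⟨fun ⟨k, hk⟩ => hk.trans (hu_mem k).2, fun hz => (hu_lim.eventually_const_lt hz).exists⟩
  have hlim := tendsto_setIntegral_of_monotone (μ := volume) (s := fun k => ball (0 : 𝔼) (u k))
    (f := fun z => ‖w - z‖ ^ ((2 : ℝ) - n)) (fun k => measurableSet_ball)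
    (fun j k hjk => ball_subset_ball (hu_mono.monotone hjk))
    (hunion ▸ integrableOn_ball_norm_sub_rpow hn (by linarith) w s)
  rw [hunion] at hlim
  refine tendsto_nhds_unique hlim (Tendsto.congr (fun k =>
    (hlt (u k) (hu_mem k).1 ((hu_mem k).2.trans_le hsw)).symm) ?_)
  exact ((hu_lim.pow n).const_mul _).mul_const _

theorem integrable_prod_norm_sub_rpow_mul (hn : 0 < n) {a : ℝ} (ha : 0 < n + a) {A B : Set 𝔼}
    (hA : MeasurableSet A) (hB : MeasurableSet B) (hAb : Bornology.IsBounded A)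
    (hBb : Bornology.IsBounded B) {f : 𝔼 → ℝ} (hf : IntegrableOn f B) :
    Integrable (fun p : 𝔼 × 𝔼 => ‖p.2 - p.1‖ ^ a * f p.2)
      ((volume.restrict A).prod (volume.restrict B)) := by
  obtain ⟨R₁, hR₁⟩ := hAb.subset_ball (0 : 𝔼)
  obtain ⟨R₂, hR₂⟩ := hBb.subset_ball (0 : 𝔼)
  have h := (hf.integrable_indicator hB).convolution_integrand (ContinuousLinearMap.mul ℝ ℝ)
    ((integrableOn_ball_norm_rpow hn ha (R₁ + R₂)).integrable_indicator measurableSet_ball)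
  rw [Measure.prod_restrict]
  refine (h.integrableOn (s := A ×ˢ B)).congr_fun (fun p hp => ?_) (hA.prod hB)
  have h1 : ‖p.1‖ < R₁ := by simpa using hR₁ hp.1
  have h2 : ‖p.2‖ < R₂ := by simpa using hR₂ hp.2
  have hmem : p.1 - p.2 ∈ ball (0 : 𝔼) (R₁ + R₂) := by
    rw [mem_ball, dist_zero_right]
    exact (norm_sub_le _ _).trans_lt (by linarith)
  simp only [ContinuousLinearMap.mul_apply', Set.indicator_of_mem hp.2, Set.indicator_of_mem hmem]
  rw [norm_sub_rev, mul_comm]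

theorem integrable_prod_norm_sub_rpow (hn : 0 < n) {a : ℝ} (ha : 0 < n + a) (R : ℝ) :
    Integrable (fun p : 𝔼 × 𝔼 => ‖p.1 - p.2‖ ^ a)
      ((volume.restrict (ball 0 R)).prod (volume.restrict (ball 0 R))) := by
  have h := integrable_prod_norm_sub_rpow_mul hn ha (measurableSet_ball (x := (0 : 𝔼)) (ε := R))
    (measurableSet_ball (x := (0 : 𝔼)) (ε := R)) isBounded_ball isBounded_ball (f := fun _ => 1)
    (integrableOn_const measure_ball_lt_top.ne)
  simpa [norm_sub_rev] using h

theorem setIntegral_ball_setIntegral_ball_norm_sub_rpow (hn : 0 < n) :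
    ∫ v in ball (0 : 𝔼) 1, ∫ z in ball (0 : 𝔼) 1, ‖v - z‖ ^ ((2 : ℝ) - n)
      = 2 * n * volume.real (ball (0 : 𝔼) 1) ^ 2 / (n + 2) := by
  have : Nontrivial 𝔼 := Module.nontrivial_of_finrank_pos (R := ℝ) (by simpa using hn)
  set μ : Measure 𝔼 := volume.restrict (ball (0 : 𝔼) 1)
  let S : Set (𝔼 × 𝔼) := {p | ‖p.2‖ < ‖p.1‖}
  let T : Set (𝔼 × 𝔼) := {p | ‖p.1‖ < ‖p.2‖}
  let k : 𝔼 × 𝔼 → ℝ := fun p => ‖p.1 - p.2‖ ^ ((2 : ℝ) - n)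
  have hk : Integrable k (μ.prod μ) := integrable_prod_norm_sub_rpow hn (by linarith) 1
  have hS : Integrable (S.indicator k) (μ.prod μ) :=
    hk.indicator (measurableSet_lt (by fun_prop) (by fun_prop))
  have hT : Integrable (T.indicator k) (μ.prod μ) :=
    hk.indicator (measurableSet_lt (by fun_prop) (by fun_prop))
  have hsplit : k =ᵐ[μ.prod μ] fun p => S.indicator k p + T.indicator k p := by
    have hmeas : MeasurableSet {p : 𝔼 × 𝔼 | ‖p.1‖ = ‖p.2‖}ᶜ :=
      (measurableSet_eq_fun (by fun_prop) (by fun_prop)).compl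
    have hnull : ∀ᵐ p ∂μ.prod μ, p ∈ {p : 𝔼 × 𝔼 | ‖p.1‖ = ‖p.2‖}ᶜ := by
      rw [Measure.ae_prod_mem_iff_ae_ae_mem hmeas]
      refine Eventually.of_forall fun v => ae_restrict_of_ae ?_
      filter_upwards [measure_eq_zero_iff_ae_notMem.mp
        (Measure.addHaar_sphere (volume : Measure 𝔼) 0 ‖v‖)] with z hz h
      exact hz (by simpa using h.symm)
    filter_upwards [hnull] with p hp
    rcases lt_or_gt_of_ne (show ‖p.1‖ ≠ ‖p.2‖ from hp) with h | h
    · simp [S, T, Set.indicator, h, h.le]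
    · simp [S, T, Set.indicator, h, h.le]
  have hsymm : ∫ p, T.indicator k p ∂μ.prod μ = ∫ p, S.indicator k p ∂μ.prod μ := by
    rw [← integral_prod_swap]
    refine integral_congr_ae (Eventually.of_forall fun p => ?_)
    simp [S, T, k, Set.indicator, norm_sub_rev]
  have hinner : ∀ v ∈ ball (0 : 𝔼) 1, ∫ z, S.indicator k (v, z) ∂μ
      = volume.real (ball (0 : 𝔼) 1) * ‖v‖ ^ (2 : ℝ) := fun v hv => by
    have e : ∀ z, S.indicator k (v, z)
        = (ball (0 : 𝔼) ‖v‖).indicator (fun z => ‖v - z‖ ^ ((2 : ℝ) - n)) z := fun z => by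
      simp [S, k, Set.indicator]
    have hsub : ball (0 : 𝔼) ‖v‖ ⊆ ball 0 1 := ball_subset_ball (by simpa using (mem_ball.mp hv).le)
    simp only [e, μ]
    rw [setIntegral_indicator measurableSet_ball, Set.inter_eq_right.mpr hsub]
    rcases eq_or_ne v 0 with rfl | hv0
    · simp
    · have hpos := norm_pos_iff.mpr hv0
      rw [setIntegral_ball_norm_sub_rpow hn hpos le_rfl, mul_assoc, ← Real.rpow_natCast,
        ← Real.rpow_add hpos]
      congr 2
      ring
  rw [integral_integral hk, integral_congr_ae hsplit, integral_add hS hT, hsymm,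
    integral_prod _ hS, setIntegral_congr_fun measurableSet_ball hinner, integral_const_mul,
    setIntegral_ball_norm_rpow hn (by positivity)]
  ring

/-- The difference at `w` between the potential of the uniform probability measure on the unit ball
and that of the Dirac mass at its centre, for the kernel `‖·‖ ^ (2 - n)`. -/
noncomputable def ballPotentialDefect (w : 𝔼) : ℝ :=
  (volume.real (ball (0 : 𝔼) 1))⁻¹ * (∫ z in ball (0 : 𝔼) 1, ‖w - z‖ ^ ((2 : ℝ) - n))
    - ‖w‖ ^ ((2 : ℝ) - n)

theorem volume_real_unitBall_pos : 0 < volume.real (ball (0 : 𝔼) 1) :=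
  ENNReal.toReal_pos (measure_ball_pos _ _ one_pos).ne' (by finiteness)

theorem ballPotentialDefect_of_one_le_norm (hn : 0 < n) {w : 𝔼} (hw : 1 ≤ ‖w‖) :
    ballPotentialDefect w = 0 := by
  have := (volume_real_unitBall_pos (n := n)).ne'
  rw [ballPotentialDefect, setIntegral_ball_norm_sub_rpow hn one_pos hw]
  field_simp
  simp

theorem integrableOn_ballPotentialDefect (hn : 0 < n) :
    IntegrableOn (ballPotentialDefect : 𝔼 → ℝ) (ball 0 1) :=
  ((integrable_prod_norm_sub_rpow hn (by linarith) 1).integral_prod_left.const_mul _).sub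
    (integrableOn_ball_norm_rpow hn (by linarith) 1)

theorem setIntegral_ballPotentialDefect (hn : 0 < n) :
    ∫ w in ball (0 : 𝔼) 1, ballPotentialDefect w
      = -(n * (n - 2) * volume.real (ball (0 : 𝔼) 1) / (2 * (n + 2))) := by
  have := (volume_real_unitBall_pos (n := n)).ne'
  simp only [ballPotentialDefect]
  rw [integral_sub
      ((integrable_prod_norm_sub_rpow hn (by linarith) 1).integral_prod_left.const_mul _)
      (integrableOn_ball_norm_rpow hn (by linarith) 1), integral_const_mul,
    setIntegral_ball_setIntegral_ball_norm_sub_rpow hn,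
    setIntegral_ball_norm_rpow hn (by linarith)]
  have h2 : (n : ℝ) + (2 - n) = 2 := by ring
  rw [h2]
  field_simp
  ring

theorem setIntegral_ball_eq_pow_mul (g : 𝔼 → ℝ) (x : 𝔼) {r : ℝ} (hr : 0 < r) :
    ∫ y in ball x r, g y = r ^ n * ∫ v in ball (0 : 𝔼) 1, g (x + r • v) := by
  have h := Measure.integral_comp_smul (volume : Measure 𝔼)
    (fun y => (ball x r).indicator g (x + y)) r
  rw [integral_add_left_eq_self, integral_indicator measurableSet_ball, finrank_euclideanSpace,
    Fintype.card_fin, abs_of_pos (by positivity), smul_eq_mul] at h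
  have e : ∀ v : 𝔼, (ball x r).indicator g (x + r • v)
      = (ball (0 : 𝔼) 1).indicator (fun v => g (x + r • v)) v := fun v => by
    simp [Set.indicator, norm_smul, abs_of_pos hr, hr]
  simp only [e] at h
  rw [integral_indicator measurableSet_ball] at h
  rw [h, mul_inv_cancel_left₀ (by positivity)]

theorem volume_real_ball_eq (x : 𝔼) {r : ℝ} (hr : 0 < r) :
    volume.real (ball x r) = r ^ n * volume.real (ball (0 : 𝔼) 1) := by
  have h := setIntegral_ball_eq_pow_mul (fun _ : 𝔼 => 1) x hr
  simpa using h

theorem inv_volume_mul_setIntegral_ball_sub_eq (x y : 𝔼) {r : ℝ} (hr : 0 < r) :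
    (volume.real (ball x r))⁻¹ * (∫ z in ball x r, ‖y - z‖ ^ ((2 : ℝ) - n))
        - ‖y - x‖ ^ ((2 : ℝ) - n)
      = r ^ ((2 : ℝ) - n) * ballPotentialDefect (r⁻¹ • (y - x)) := by
  have hω := (volume_real_unitBall_pos (n := n)).ne'
  have hscale : ∀ v : 𝔼, ‖y - x - r • v‖ ^ ((2 : ℝ) - n)
      = r ^ ((2 : ℝ) - n) * ‖r⁻¹ • (y - x) - v‖ ^ ((2 : ℝ) - n) := fun v => by
    rw [← Real.mul_rpow hr.le (norm_nonneg _)]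
    congr 1
    rw [← abs_of_pos hr, ← Real.norm_eq_abs, ← norm_smul, Real.norm_eq_abs, abs_of_pos hr,
      smul_sub, smul_inv_smul₀ hr.ne']
  have h0 := hscale 0
  simp only [smul_zero, sub_zero] at h0
  rw [setIntegral_ball_eq_pow_mul _ x hr, volume_real_ball_eq x hr, h0, ballPotentialDefect]
  simp only [← sub_sub, hscale, integral_const_mul]
  field_simp

theorem average_newtonianPotential_sub_eq (hn : 0 < n) {Ω : Set 𝔼} (hΩ : MeasurableSet Ω)
    (hΩb : Bornology.IsBounded Ω) {f : 𝔼 → ℝ} {C : ℝ}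
    (hfm : AEStronglyMeasurable f (volume.restrict Ω)) (hC : ∀ y ∈ Ω, |f y| ≤ C) {x : 𝔼} {r : ℝ}
    (hr : 0 < r) (hrΩ : ball x r ⊆ Ω) :
    (volume.real (ball x r))⁻¹ * (∫ y in ball x r, newtonianPotential Ω f y)
        - newtonianPotential Ω f x
      = fundConst n * r ^ 2 * ∫ v in ball (0 : 𝔼) 1, ballPotentialDefect v * f (x + r • v) := by
  have hCae : ∀ᵐ y ∂volume.restrict Ω, ‖f y‖ ≤ C := (ae_restrict_mem hΩ).mono fun y hy => hC y hy
  have : IsFiniteMeasure (volume.restrict Ω) := ⟨by simpa using hΩb.measure_lt_top⟩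
  have hfi : IntegrableOn f Ω := Integrable.of_bound hfm C hCae
  have hprod := integrable_prod_norm_sub_rpow_mul hn (a := (2 : ℝ) - n) (by linarith)
    (measurableSet_ball (x := x) (ε := r)) hΩ isBounded_ball hΩb hfi
  have hpot : ∀ z, newtonianPotential Ω f z
      = fundConst n * ∫ y in Ω, ‖y - z‖ ^ ((2 : ℝ) - n) * f y := fun z => by
    rw [← integral_const_mul]
    simp only [newtonianPotential, fundSol, mul_assoc]
  have hleft : IntegrableOn (fun y => (volume.real (ball x r))⁻¹ *
      ((∫ z in ball x r, ‖y - z‖ ^ ((2 : ℝ) - n)) * f y)) Ω := by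
    have := hprod.integral_prod_right
    simp only [integral_mul_const] at this
    exact this.const_mul _
  have hright : IntegrableOn (fun y => ‖y - x‖ ^ ((2 : ℝ) - n) * f y) Ω := by
    obtain ⟨R, hR⟩ := hΩb.subset_ball (0 : 𝔼)
    have hk := (integrableOn_ball_norm_sub_rpow hn (a := (2 : ℝ) - n) (by linarith) x R).mono_set hR
    simp only [norm_sub_rev x] at hk
    exact Integrable.mul_bdd hk hfm hCae
  have hswap : (volume.real (ball x r))⁻¹ * (∫ z in ball x r, newtonianPotential Ω f z)
      - newtonianPotential Ω f x = fundConst n * ∫ y in Ω,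
        r ^ ((2 : ℝ) - n) * (ballPotentialDefect (r⁻¹ • (y - x)) * f y) := by
    simp only [hpot, integral_const_mul]
    rw [integral_integral_swap hprod]
    simp only [integral_mul_const]
    rw [mul_left_comm, ← integral_const_mul, ← mul_sub, ← integral_sub hleft hright]
    simp only [← mul_assoc, ← sub_mul, inv_volume_mul_setIntegral_ball_sub_eq x _ hr]
    simp only [mul_assoc, integral_const_mul]
  rw [hswap, integral_const_mul]
  have hsupp : ∫ y in Ω, ballPotentialDefect (r⁻¹ • (y - x)) * f y
      = ∫ y in ball x r, ballPotentialDefect (r⁻¹ • (y - x)) * f y := by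
    refine setIntegral_eq_of_subset_of_forall_sdiff_eq_zero hΩ hrΩ fun y hy => ?_
    rw [ballPotentialDefect_of_one_le_norm hn, zero_mul]
    have : r ≤ ‖y - x‖ := by simpa [dist_eq_norm] using hy.2
    rw [norm_smul, norm_inv, Real.norm_eq_abs, abs_of_pos hr, ← div_eq_inv_mul]
    exact (one_le_div hr).mpr this
  have hpow : r ^ ((2 : ℝ) - n) * r ^ n = r ^ 2 := by
    rw [← Real.rpow_natCast, ← Real.rpow_natCast, ← Real.rpow_add hr]
    simp
  rw [hsupp, setIntegral_ball_eq_pow_mul _ x hr, ← mul_assoc (r ^ ((2 : ℝ) - n)), hpow, mul_assoc]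
  simp [smul_smul, inv_mul_cancel₀ hr.ne']

theorem tendsto_setIntegral_ball_mul_comp_add_smul {K : 𝔼 → ℝ} (hK : IntegrableOn K (ball 0 1))
    {Ω : Set 𝔼} (hΩ : IsOpen Ω) {f : 𝔼 → ℝ} (hf : ContinuousOn f Ω) {C : ℝ}
    (hC : ∀ y ∈ Ω, |f y| ≤ C) {x : 𝔼} (hx : x ∈ Ω) :
    Tendsto (fun r : ℝ => ∫ v in ball (0 : 𝔼) 1, K v * f (x + r • v)) (𝓝[>] 0)
      (𝓝 ((∫ v in ball (0 : 𝔼) 1, K v) * f x)) := by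
  obtain ⟨ε, hε, hεΩ⟩ := Metric.isOpen_iff.mp hΩ x hx
  have hmem : ∀ r ∈ Set.Ioo 0 ε, ∀ v ∈ ball (0 : 𝔼) 1, x + r • v ∈ Ω := fun r hr v hv => by
    apply hεΩ
    have hv' : ‖v‖ < 1 := by simpa using hv
    simp only [mem_ball, dist_self_add_left, norm_smul, Real.norm_eq_abs, abs_of_pos hr.1]
    nlinarith [hr.1, hr.2, norm_nonneg v]
  have hev : ∀ᶠ r : ℝ in 𝓝[>] 0, r ∈ Set.Ioo 0 ε := Ioo_mem_nhdsGT hε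
  rw [← integral_mul_const]
  refine tendsto_integral_filter_of_dominated_convergence (fun v => ‖K v‖ * C)
    (hev.mono fun r hr => ?_) (hev.mono fun r hr => ?_) (hK.norm.mul_const C) ?_
  · refine hK.aestronglyMeasurable.mul (ContinuousOn.aestronglyMeasurable ?_ measurableSet_ball)
    exact hf.comp (by fun_prop) (hmem r hr)
  · filter_upwards [ae_restrict_mem measurableSet_ball] with v hv
    rw [norm_mul]
    exact mul_le_mul_of_nonneg_left (hC _ (hmem r hr v hv)) (norm_nonneg _)
  · refine Eventually.of_forall fun v => Tendsto.const_mul _ ?_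
    have hlim : Tendsto (fun r : ℝ => x + r • v) (𝓝[>] 0) (𝓝 x) := by
      have : Continuous fun r : ℝ => x + r • v := by fun_prop
      simpa using (this.tendsto 0).mono_left nhdsWithin_le_nhds
    exact (hf.continuousAt (hΩ.mem_nhds hx)).tendsto.comp hlim

end Euclidean

/-- Pizzetti's Theorem: for `Ω ⊆ ℝⁿ` bounded open, `n ≥ 3`, and
`f : Ω → ℝ` bounded continuous, the asymptotic average Laplacian of the Newtonian
potential `u_f` exists at every `x ∈ Ω` and equals `-f(x)`:
`2(n+2)·((1/|B(x,r)|)∫_{B(x,r)} u_f − u_f(x))/r² → −f(x)` as `r → 0⁺`. -/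
theorem pizzetti_theorem {n : ℕ} (hn : 3 ≤ n)
    (Ω : Set (EuclideanSpace ℝ (Fin n))) (hΩopen : IsOpen Ω)
    (hΩbdd : Bornology.IsBounded Ω)
    (f : EuclideanSpace ℝ (Fin n) → ℝ) (hfcont : ContinuousOn f Ω)
    (hfbdd : ∃ C : ℝ, ∀ x ∈ Ω, |f x| ≤ C)
    (x : EuclideanSpace ℝ (Fin n)) (hx : x ∈ Ω) :
    Tendsto
      (fun r : ℝ =>
        2 * (n + 2) *
          ((((volume (ball x r)).toReal)⁻¹ * (∫ y in ball x r, newtonianPotential Ω f y)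
              - newtonianPotential Ω f x) / r ^ 2))
      (𝓝[>] 0) (𝓝 (-f x)) := by
  obtain ⟨C, hC⟩ := hfbdd
  obtain ⟨ε, hε, hεΩ⟩ := Metric.isOpen_iff.mp hΩopen x hx
  have hn0 : 0 < n := by omega
  have hω := (volume_real_unitBall_pos (n := n)).ne'
  have hn3 : (3 : ℝ) ≤ n := by exact_mod_cast hn
  have hn2 : (n : ℝ) - 2 ≠ 0 := by linarith
  have hlim := (tendsto_setIntegral_ball_mul_comp_add_smul (integrableOn_ballPotentialDefect hn0)
    hΩopen hfcont hC hx).const_mul (2 * ((n : ℝ) + 2) * fundConst n)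
  have hval : 2 * ((n : ℝ) + 2) * fundConst n *
      ((∫ v in ball (0 : EuclideanSpace ℝ (Fin n)) 1, ballPotentialDefect v) * f x) = -f x := by
    rw [setIntegral_ballPotentialDefect hn0, fundConst, unitBallVol, ← measureReal_def]
    field_simp
  rw [hval] at hlim
  refine hlim.congr' ?_
  filter_upwards [Ioo_mem_nhdsGT hε] with r hr
  rw [← measureReal_def, average_newtonianPotential_sub_eq hn0 hΩopen.measurableSet hΩbdd
    (hfcont.aestronglyMeasurable hΩopen.measurableSet) hC hr.1
    ((ball_subset_ball hr.2.le).trans hεΩ)]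
  have := hr.1.ne'
  field_simp
end
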